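/- Let K be any field and let M be a graded Cohen-Macaulay module of projective dimension ≤ c over K[x_1,...,x_n], generated in degrees ≥ 0. If β_{p+1,p+1}(M) = 0 for some p ≥ 1, then β_{p,p}(M) ≤ ((c+2−p)/(2p)) · β_{p−1,p−1}(M). -/

import Mathlib

open MvPolynomial Finset Module

noncomputable section

/-- The standard graded polynomial ring `S = K[x_1, …, x_n]`. -/
abbrev PolyS (K : Type) [Field K] (n : ℕ) : Type := MvPolynomial (Fin n) K

/-- The `K`-subspace of homogeneous polynomials of integer degree `z`
(it is `0` if `z < 0`). -/
def homogZ (K : Type) [Field K] (n : ℕ) (z : ℤ) : Submodule K (PolyS K n) :=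
  ⨆ (_ : 0 ≤ z), MvPolynomial.homogeneousSubmodule (Fin n) K z.toNat

/-- The degree-`ℓ` piece of the graded free module `⊕ₚ S(-dg p)`. -/
def freePiece {K : Type} [Field K] {n r : ℕ} (dg : Fin r → ℤ) (ℓ : ℤ) :
    Submodule K (Fin r → PolyS K n) :=
  Submodule.pi Set.univ fun p => homogZ K n (ℓ - dg p)

/-- A (homologically indexed) finite complex of graded free `S`-modules
`F₀ ← F₁ ← ⋯ ← F_len ← 0`, where `Fᵢ = ⊕ₚ S(-deg i p)` and the (degree `0`)
map `Fᵢ₊₁ → Fᵢ` is given by the matrix `dd i`, whose entries are homogeneous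
of the appropriate degrees. -/
structure FreeComplex (K : Type) [Field K] (n : ℕ) where
  len : ℕ
  rk : ℕ → ℕ
  deg : (i : ℕ) → Fin (rk i) → ℤ
  dd : (i : ℕ) → Matrix (Fin (rk i)) (Fin (rk (i+1))) (PolyS K n)
  rk_eq_zero : ∀ i, len < i → rk i = 0
  isHomog : ∀ i p q, dd i p q ∈ homogZ K n (deg (i+1) q - deg i p)
  isComplex : ∀ i, dd i * dd (i+1) = 0

variable {K : Type} [Field K] {n : ℕ}

/-- `F` is exact in positive homological degrees; that is, it is a graded free
resolution of the finitely generated graded module `M = coker (F₁ → F₀)`. -/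
def IsResolution (F : FreeComplex K n) : Prop :=
  ∀ i, LinearMap.ker ((F.dd i).mulVecLin) = LinearMap.range ((F.dd (i+1)).mulVecLin)

/-- The complex is minimal: entries of the differentials lie in the maximal ideal,
i.e. all (constant) entries between generators of equal degrees vanish. -/
def IsMinimal (F : FreeComplex K n) : Prop :=
  ∀ i p q, F.deg (i+1) q = F.deg i p → F.dd i p q = 0

/-- Betti number `β_{i,j}`: the number of generators of `Fᵢ` of degree `j`. -/
def bettiNum (F : FreeComplex K n) (i : ℕ) (j : ℤ) : ℕ :=
  (Finset.univ.filter fun p => F.deg i p = j).card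

/-- The dimension of the degree-`ℓ` piece of the module `M = coker (F₁ → F₀)`
resolved by `F`. -/
def MPieceDim (F : FreeComplex K n) (ℓ : ℤ) : ℕ :=
  finrank K ((freePiece (F.deg 0) ℓ) ⧸
    (Submodule.comap (freePiece (F.deg 0) ℓ).subtype
      ((LinearMap.range ((F.dd 0).mulVecLin)).restrictScalars K)))

/-- The Hilbert polynomial of the twisted free module `S(-a)` in `n` variables:
`binom (t - a + n - 1, n - 1)`. -/
def genHilb (n : ℕ) (a : ℤ) : Polynomial ℚ :=
  if n = 0 then 0 else
    Polynomial.C (((n - 1).factorial : ℚ))⁻¹ *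
      ∏ k ∈ Finset.range (n - 1),
        (Polynomial.X - Polynomial.C (a : ℚ) + Polynomial.C ((k : ℚ) + 1))

/-- The Hilbert polynomial of `M = coker (F₁ → F₀)`, computed from the free
resolution `F` by additivity. -/
def hilbPoly (F : FreeComplex K n) : Polynomial ℚ :=
  ∑ i ∈ Finset.range (F.len + 1),
    Polynomial.C ((-1 : ℚ) ^ i) * ∑ p : Fin (F.rk i), genHilb n (F.deg i p)

/-- The Krull dimension of a module read off from its Hilbert polynomial:
`0` for the zero polynomial (finite length), `deg + 1` otherwise. -/
def polyDim (P : Polynomial ℚ) : ℕ := if P = 0 then 0 else P.natDegree + 1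

/-- `M = coker (F₁ → F₀)` is a Cohen-Macaulay module of codimension `c`:
`F` is a minimal free resolution of length exactly `c` (so `pd M = c`, and by
Auslander–Buchsbaum `depth M = n - c`) and `dim M = n - c`. -/
def IsCMcodim (F : FreeComplex K n) (c : ℕ) : Prop :=
  IsResolution F ∧ IsMinimal F ∧ (∀ i, c < i → F.rk i = 0) ∧ F.rk c ≠ 0 ∧
    polyDim (hilbPoly F) = n - c

/-- The multiplicity `e(M)` of a module of codimension `c`, computed from the
Betti numbers of a free resolution:
`e(M) = ((-1)^c / c!) ⬝ Σ_{i,j} (-1)^i β_{i,j} j^c`. -/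
def multQ (F : FreeComplex K n) (c : ℕ) : ℚ :=
  ((-1 : ℚ) ^ c / c.factorial) *
    ∑ i ∈ Finset.range (F.len + 1),
      (-1 : ℚ) ^ i * ∑ p : Fin (F.rk i), ((F.deg i p : ℚ)) ^ c




/-! ### A recursive model of the exterior algebra with coefficients in `M` -/

def XExt (M : Type) : ℕ → Type
  | 0 => M
  | n + 1 => XExt M n × XExt M n

instance XExt.inst (M : Type) [AddCommGroup M] : (n : ℕ) → AddCommGroup (XExt M n)
  | 0 => inferInstanceAs (AddCommGroup M)
  | n + 1 => @Prod.instAddCommGroup _ _ (XExt.inst M n) (XExt.inst M n)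

namespace XExt
variable {M : Type} [AddCommGroup M]

def of0 : M →+ XExt M 0 := AddMonoidHom.id M
def to0 : XExt M 0 →+ M := AddMonoidHom.id M
def fst {n : ℕ} : XExt M (n + 1) →+ XExt M n := AddMonoidHom.fst (XExt M n) (XExt M n)
def snd {n : ℕ} : XExt M (n + 1) →+ XExt M n := AddMonoidHom.snd (XExt M n) (XExt M n)
def inl {n : ℕ} : XExt M n →+ XExt M (n + 1) := AddMonoidHom.inl (XExt M n) (XExt M n)
def inr {n : ℕ} : XExt M n →+ XExt M (n + 1) := AddMonoidHom.inr (XExt M n) (XExt M n)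

lemma fst_inl {n : ℕ} (x : XExt M n) : fst (inl x) = x := rfl
lemma snd_inl {n : ℕ} (x : XExt M n) : snd (inl x) = 0 := rfl
lemma fst_inr {n : ℕ} (x : XExt M n) : fst (inr x) = 0 := rfl
lemma snd_inr {n : ℕ} (x : XExt M n) : snd (inr x) = x := rfl
lemma fst_mk {n : ℕ} (x y : XExt M n) : fst (inl x + inr y) = x := by
  rw [map_add, fst_inl, fst_inr, add_zero]
lemma snd_mk {n : ℕ} (x y : XExt M n) : snd (inl x + inr y) = y := by
  rw [map_add, snd_inl, snd_inr, zero_add]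
lemma to0_of0 (x : M) : to0 (of0 x) = x := rfl
lemma of0_to0 (x : XExt M 0) : of0 (to0 x) = x := rfl

lemma ext' {n : ℕ} {x y : XExt M (n + 1)} (h1 : fst x = fst y) (h2 : snd x = snd y) : x = y :=
  Prod.ext h1 h2

/-- contraction operators -/
def dl : (n : ℕ) → ℕ → (XExt M n →+ XExt M n)
  | 0, _ => 0
  | n + 1, k => (inl.comp ((dl n k).comp fst)) + (if k = n then inl.comp snd else 0)
      - (inr.comp ((dl n k).comp snd))

lemma dl_zero (k : ℕ) (x : XExt M 0) : dl 0 k x = 0 := rfl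

lemma fst_dl (n k : ℕ) (x : XExt M (n + 1)) :
    fst (dl (n + 1) k x) = dl n k (fst x) + (if k = n then snd x else 0) := by
  by_cases h : k = n <;> simp [dl, h, fst_inl, fst_inr]

lemma snd_dl (n k : ℕ) (x : XExt M (n + 1)) :
    snd (dl (n + 1) k x) = - dl n k (snd x) := by
  by_cases h : k = n <;> simp [dl, h, snd_inl, snd_inr]

lemma dl_ge (n k : ℕ) (h : n ≤ k) (x : XExt M n) : dl n k x = 0 := by
  induction n with
  | zero => rfl
  | succ n ih =>
    apply ext'
    · rw [fst_dl, ih (by omega), if_neg (by omega)]; simp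
    · rw [snd_dl, ih (by omega)]; simp

lemma dl_sq (n k : ℕ) (x : XExt M n) : dl n k (dl n k x) = 0 := by
  induction n with
  | zero => rfl
  | succ n ih =>
    apply ext'
    · rw [fst_dl, fst_dl, snd_dl, map_add, ih]
      by_cases h : k = n <;> simp [h]
    · rw [snd_dl, snd_dl, map_neg, ih]; simp

lemma dl_anti (n k l : ℕ) (x : XExt M n) : dl n k (dl n l x) + dl n l (dl n k x) = 0 := by
  induction n with
  | zero => simp [dl_zero]
  | succ n ih =>
    apply ext'
    · have := ih (fst x)
      simp only [map_add, fst_dl, snd_dl, map_zero]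
      refine Eq.trans ?_ this
      by_cases h : k = n <;> by_cases h' : l = n <;> simp [h, h', dl_ge n n le_rfl] 
    · have := ih (snd x)
      simp only [map_add, snd_dl, map_zero, map_neg, neg_neg]
      exact this

lemma dl_anti' (n k l : ℕ) (x : XExt M n) : dl n k (dl n l x) = - dl n l (dl n k x) :=
  eq_neg_of_add_eq_zero_left (dl_anti n k l x)

def IsDeg : (n : ℕ) → ℕ → XExt M n → Prop
  | 0, 0, _ => True
  | 0, _ + 1, x => x = 0
  | n + 1, 0, x => IsDeg n 0 (fst x) ∧ snd x = 0
  | n + 1, p + 1, x => IsDeg n (p + 1) (fst x) ∧ IsDeg n p (snd x)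

lemma IsDeg.zero : ∀ (n p : ℕ), IsDeg n p (0 : XExt M n)
  | 0, 0 => trivial
  | 0, _ + 1 => rfl
  | n + 1, 0 => ⟨by rw [map_zero]; exact IsDeg.zero n 0, map_zero _⟩
  | n + 1, p + 1 => ⟨by rw [map_zero]; exact IsDeg.zero n _, by rw [map_zero]; exact IsDeg.zero n _⟩

lemma IsDeg.add : ∀ {n p : ℕ} {x y : XExt M n}, IsDeg n p x → IsDeg n p y → IsDeg n p (x + y)
  | 0, 0, _, _, _, _ => trivial
  | 0, _ + 1, x, y, hx, hy => by
      change x = 0 at hx; change y = 0 at hy; change x + y = 0; rw [hx, hy, add_zero]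
  | n + 1, 0, x, y, hx, hy => ⟨by rw [map_add]; exact hx.1.add hy.1, by
      rw [map_add, hx.2, hy.2, add_zero]⟩
  | n + 1, p + 1, x, y, hx, hy => ⟨by rw [map_add]; exact hx.1.add hy.1, by
      rw [map_add]; exact hx.2.add hy.2⟩

lemma IsDeg.neg : ∀ {n p : ℕ} {x : XExt M n}, IsDeg n p x → IsDeg n p (-x)
  | 0, 0, _, _ => trivial
  | 0, _ + 1, x, hx => by
      change x = 0 at hx; change -x = 0; rw [hx, neg_zero]
  | n + 1, 0, x, hx => ⟨by rw [map_neg]; exact hx.1.neg, by rw [map_neg, hx.2, neg_zero]⟩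
  | n + 1, p + 1, x, hx => ⟨by rw [map_neg]; exact hx.1.neg, by rw [map_neg]; exact hx.2.neg⟩

lemma IsDeg.sub {n p : ℕ} {x y : XExt M n} (hx : IsDeg n p x) (hy : IsDeg n p y) :
    IsDeg n p (x - y) := by
  rw [sub_eq_add_neg]; exact hx.add hy.neg

lemma IsDeg.sum {n p : ℕ} {ι : Type} (s : Finset ι) (f : ι → XExt M n)
    (h : ∀ i ∈ s, IsDeg n p (f i)) : IsDeg n p (∑ i ∈ s, f i) := by
  classical
  induction s using Finset.induction_on with
  | empty => simpa using IsDeg.zero n p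
  | insert a s ha ih =>
    rw [Finset.sum_insert ha]
    exact (h a (by simp)).add (ih fun i hi => h i (by simp [hi]))

lemma IsDeg.dl0 : ∀ {n : ℕ} (k : ℕ) {x : XExt M n}, IsDeg n 0 x → dl n k x = 0
  | 0, _, _, _ => rfl
  | n + 1, k, x, hx => by
    apply ext'
    · rw [fst_dl, IsDeg.dl0 k hx.1, hx.2]; simp
    · rw [snd_dl, hx.2]; simp

lemma IsDeg.dl : ∀ {n p : ℕ} (k : ℕ) {x : XExt M n}, IsDeg n (p + 1) x → IsDeg n p (dl n k x)
  | 0, _, _, _, _ => by rw [dl_zero]; exact IsDeg.zero _ _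
  | n + 1, 0, k, x, hx => by
    refine ⟨?_, ?_⟩
    · rw [fst_dl]
      refine (hx.1.dl k).add ?_
      split_ifs
      · exact hx.2
      · exact IsDeg.zero _ _
    · rw [snd_dl, hx.2.dl0]; simp
  | n + 1, p + 1, k, x, hx => by
    refine ⟨?_, ?_⟩
    · rw [fst_dl]
      refine (hx.1.dl k).add ?_
      split_ifs
      · exact hx.2
      · exact IsDeg.zero _ _
    · rw [snd_dl]; exact (hx.2.dl k).neg

lemma IsDeg.gt : ∀ {n p : ℕ} {x : XExt M n}, n < p → IsDeg n p x → x = 0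
  | 0, _ + 1, _, _, hx => hx
  | n + 1, p + 1, x, h, hx => by
    apply ext'
    · rw [IsDeg.gt (by omega) hx.1, map_zero]
    · rw [IsDeg.gt (by omega) hx.2, map_zero]

lemma IsDeg.sep : ∀ {n p : ℕ} {x : XExt M n}, IsDeg n (p + 1) x →
    (∀ k < n, XExt.dl n k x = 0) → x = 0
  | 0, _, _, hx, _ => hx
  | n + 1, p, x, hx, h => by
    have h2 : snd x = 0 := by
      have := congrArg fst (h n (by omega))
      rw [fst_dl, dl_ge n n le_rfl] at this
      simpa using this
    have h1 : fst x = 0 := by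
      apply IsDeg.sep hx.1
      intro k hk
      have := congrArg fst (h k (by omega))
      rw [fst_dl, h2] at this
      simpa using this
    exact ext' (by rw [h1, map_zero]) (by rw [h2, map_zero])

theorem lemmaA : ∀ (n p m : ℕ), n + 1 = p + m → ∀ w : ℕ → XExt M n,
    (∀ i < p, IsDeg n p (w i)) →
    (∀ j < m, ∑ i ∈ range p, dl n (i + j) (w i) = 0) → ∀ i < p, w i = 0 := by
  intro n
  induction n with
  | zero =>
    intro p m hpm w hd _ i hi
    exact (hd i hi).gt (by omega)
  | succ n ih =>
    intro p m hpm w hd hr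
    rcases p with _ | q
    · intro i hi; omega
    rcases m with _ | r
    · intro i hi
      exact (hd i hi).gt (by omega)
    have hf : ∀ j < r + 1, ∑ i ∈ range (q + 1), dl n (i + j) (fst (w i)) +
        (if j = r then snd (w q) else 0) = 0 := by
      intro j hj
      have := congrArg fst (hr j hj)
      rw [map_sum, map_zero] at this
      simp only [fst_dl, Finset.sum_add_distrib] at this
      rw [Finset.sum_range_succ (fun x => if x + j = n then snd (w x) else 0),
        Finset.sum_eq_zero (s := range q), zero_add] at this
      · have e : (q + j = n) = (j = r) := by apply propext; omega
        simp only [e] at this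
        exact this
      · intro i hi; rw [Finset.mem_range] at hi; rw [if_neg (by omega)]
    have ha : ∀ i < q + 1, fst (w i) = 0 := by
      apply ih (q + 1) r (by omega) (fun i => fst (w i)) (fun i hi => (hd i hi).1)
      intro j hj
      have := hf j (by omega)
      rw [if_neg (by omega), add_zero] at this
      exact this
    have hbq : snd (w q) = 0 := by
      have := hf r (by omega)
      rw [if_pos rfl, Finset.sum_eq_zero, zero_add] at this
      · exact this
      · intro i hi; rw [ha i (Finset.mem_range.1 hi), map_zero]
    have hb : ∀ i < q, snd (w i) = 0 := by
      apply ih q (r + 1) (by omega) (fun i => snd (w i)) (fun i hi => (hd i (by omega)).2)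
      intro j hj
      have := congrArg snd (hr j hj)
      rw [map_sum, map_zero] at this
      simp only [snd_dl, Finset.sum_neg_distrib, neg_eq_zero] at this
      rw [Finset.sum_range_succ, hbq, map_zero, add_zero] at this
      exact this
    intro i hi
    apply ext'
    · rw [ha i hi, map_zero]
    · rw [map_zero]
      rcases Nat.lt_succ_iff_lt_or_eq.1 hi with h | h
      · exact hb i h
      · rw [h, hbq]

lemma alt_sum (n p j : ℕ) (u : ℕ → ℕ → XExt M n) (hs : ∀ i i', u i i' = u i' i) :
    ∑ i ∈ range p, ∑ i' ∈ range p, dl n (i + j) (dl n (i' + j) (u i i')) = 0 := by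
  induction p with
  | zero => simp
  | succ p ih =>
    rw [Finset.sum_range_succ]
    simp only [Finset.sum_range_succ _ p, Finset.sum_add_distrib]
    rw [ih, dl_sq, zero_add, add_zero, ← Finset.sum_add_distrib]
    apply Finset.sum_eq_zero
    intro i _
    rw [hs p i, dl_anti]

lemma anti_sum (n p j j' : ℕ) (u : ℕ → ℕ → XExt M n) (hs : ∀ i i', u i i' = u i' i) :
    ∑ i ∈ range p, ∑ i' ∈ range p, dl n (i + j) (dl n (i' + j') (u i i')) +
    ∑ i ∈ range p, ∑ i' ∈ range p, dl n (i + j') (dl n (i' + j) (u i i')) = 0 := by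
  rw [Finset.sum_comm, ← Finset.sum_add_distrib]
  apply Finset.sum_eq_zero
  intro i _
  rw [← Finset.sum_add_distrib]
  apply Finset.sum_eq_zero
  intro i' _
  rw [hs i' i, dl_anti]

theorem lemmaB : ∀ (n p m : ℕ), n + 1 = p + m → ∀ w : ℕ → ℕ → XExt M n,
    (∀ i < p, ∀ j < m, IsDeg n p (w i j)) →
    (∀ j < m, ∑ i ∈ range p, dl n (i + j) (w i j) = 0) →
    (∀ j < m, ∀ j' < m, ∑ i ∈ range p, dl n (i + j) (w i j') +
      ∑ i ∈ range p, dl n (i + j') (w i j) = 0) →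
    ∃ u : ℕ → ℕ → XExt M n, (∀ i i', u i i' = u i' i) ∧
      (∀ i < p, ∀ i' < p, IsDeg n (p + 1) (u i i')) ∧
      ∀ i < p, ∀ j < m, w i j = ∑ i' ∈ range p, dl n (i' + j) (u i i') := by
  intro n
  induction n with
  | zero =>
    intro p m hpm w hd h1 h2
    refine ⟨fun _ _ => 0, fun _ _ => rfl, fun _ _ _ _ => IsDeg.zero _ _, ?_⟩
    intro i hi j hj; omega
  | succ n ih =>
    intro p m hpm w hd h1 h2
    rcases p with _ | q
    · exact ⟨fun _ _ => 0, fun _ _ => rfl, fun _ _ _ _ => IsDeg.zero _ _, fun i hi => by omega⟩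
    rcases m with _ | r
    · exact ⟨fun _ _ => 0, fun _ _ => rfl, fun _ _ _ _ => IsDeg.zero _ _,
        fun i hi j hj => by omega⟩
    have hif : ∀ j < r + 1, ∀ f : ℕ → XExt M n,
        ∑ i ∈ range (q + 1), (if i + j = n then f i else 0) = if j = r then f q else 0 := by
      intro j hj f
      rw [Finset.sum_range_succ, Finset.sum_eq_zero, zero_add]
      · congr 1; apply propext; omega
      · intro i hi; rw [Finset.mem_range] at hi; rw [if_neg (by omega)]
    set a : ℕ → ℕ → XExt M n := fun i j => fst (w i j) with ha
    set b : ℕ → ℕ → XExt M n := fun i j => snd (w i j) with hb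
    have h1f : ∀ j < r + 1, ∑ i ∈ range (q + 1), dl n (i + j) (a i j) +
        (if j = r then b q j else 0) = 0 := by
      intro j hj
      have := congrArg fst (h1 j hj)
      rw [map_sum, map_zero] at this
      simp only [fst_dl, Finset.sum_add_distrib] at this
      rw [hif j hj (fun i => snd (w i j))] at this
      exact this
    have h1s : ∀ j < r + 1, ∑ i ∈ range (q + 1), dl n (i + j) (b i j) = 0 := by
      intro j hj
      have := congrArg snd (h1 j hj)
      rw [map_sum, map_zero] at this
      simpa only [snd_dl, Finset.sum_neg_distrib, neg_eq_zero] using this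
    have h2f : ∀ j < r + 1, ∀ j' < r + 1, (∑ i ∈ range (q + 1), dl n (i + j) (a i j') +
        (if j = r then b q j' else 0)) + (∑ i ∈ range (q + 1), dl n (i + j') (a i j) +
        (if j' = r then b q j else 0)) = 0 := by
      intro j hj j' hj'
      have := congrArg fst (h2 j hj j' hj')
      rw [map_add, map_sum, map_sum, map_zero] at this
      simp only [fst_dl, Finset.sum_add_distrib] at this
      rw [hif j hj (fun i => snd (w i j')), hif j' hj' (fun i => snd (w i j))] at this
      exact this
    have h2s : ∀ j < r + 1, ∀ j' < r + 1, ∑ i ∈ range (q + 1), dl n (i + j) (b i j') +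
        ∑ i ∈ range (q + 1), dl n (i + j') (b i j) = 0 := by
      intro j hj j' hj'
      have := congrArg snd (h2 j hj j' hj')
      rw [map_add, map_sum, map_sum, map_zero] at this
      simp only [snd_dl, Finset.sum_neg_distrib] at this
      rw [← neg_add, neg_eq_zero] at this
      exact this
    obtain ⟨u1, u1s, u1d, u1w⟩ := ih (q + 1) r (by omega) a
      (fun i hi j hj => (hd i hi j (by omega)).1)
      (fun j hj => by
        have := h1f j (by omega)
        rwa [if_neg (by omega), add_zero] at this)
      (fun j hj j' hj' => by
        have := h2f j (by omega) j' (by omega)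
        rwa [if_neg (by omega), if_neg (by omega), add_zero, add_zero] at this)
    set c : ℕ → XExt M n := fun i => a i r - ∑ i' ∈ range (q + 1), dl n (i' + r) (u1 i i') with hc
    have har : ∀ i, a i r = c i + ∑ i' ∈ range (q + 1), dl n (i' + r) (u1 i i') := by
      intro i; simp [hc]
    have hcd : ∀ i < q + 1, IsDeg n (q + 1) (c i) := by
      intro i hi
      refine (hd i hi r (by omega)).1.sub (IsDeg.sum _ _ ?_)
      intro i' hi'
      exact (u1d i hi i' (Finset.mem_range.1 hi')).dl _
    have hF : ∀ j < r + 1, b q j + ∑ i ∈ range (q + 1), dl n (i + j) (c i) = 0 := by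
      intro j hj
      by_cases hjr : j = r
      · subst hjr
        have := h1f j hj
        rw [if_pos rfl] at this
        simp only [har, map_add, map_sum, Finset.sum_add_distrib] at this
        rw [alt_sum n (q + 1) j u1 u1s, add_zero, add_comm] at this
        exact this
      · have := h2f j hj r (by omega)
        rw [if_neg hjr, if_pos rfl, add_zero] at this
        have e : ∑ i ∈ range (q + 1), dl n (i + r) (a i j) =
            ∑ i ∈ range (q + 1), ∑ i' ∈ range (q + 1), dl n (i + r) (dl n (i' + j) (u1 i i')) := by
          apply Finset.sum_congr rfl
          intro i hi
          rw [u1w i (Finset.mem_range.1 hi) j (by omega), map_sum]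
        rw [e] at this
        simp only [har, map_add, map_sum, Finset.sum_add_distrib] at this
        have h3 := anti_sum n (q + 1) j r u1 u1s
        have gen : ∀ S A B b : XExt M n, S + A + (B + b) = 0 → A + B = 0 → b + S = 0 := by
          intro S A B b e1 e2
          have : b + S = (S + A + (B + b)) - (A + B) := by abel
          rw [this, e1, e2, sub_zero]
        exact gen _ _ _ _ this h3
    have hF' : ∀ j < r + 1, b q j = - ∑ i ∈ range (q + 1), dl n (i + j) (c i) :=
      fun j hj => eq_neg_of_add_eq_zero_left (hF j hj)
    have key : ∀ j < r + 1, ∀ j' < r + 1,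
        ∑ i ∈ range q, dl n (i + j) (b i j' + dl n (q + j') (c i)) =
        ∑ i ∈ range (q + 1), dl n (i + j) (b i j') +
          (∑ i ∈ range q, dl n (i + j) (dl n (q + j') (c i)) +
            ∑ i ∈ range q, dl n (q + j) (dl n (i + j') (c i))) +
            dl n (q + j) (dl n (q + j') (c q)) := by
      intro j hj j' hj'
      simp only [map_add, Finset.sum_add_distrib]
      rw [Finset.sum_range_succ, hF' j' hj', Finset.sum_range_succ, map_neg, map_add, map_sum]
      abel
    obtain ⟨v, vs, vd, vw⟩ := ih q (r + 1) (by omega)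
      (fun i j => - (b i j + dl n (q + j) (c i)))
      (fun i hi j hj => ((hd i (by omega) j hj).2.add ((hcd i (by omega)).dl _)).neg)
      (fun j hj => by
        simp only [map_neg, Finset.sum_neg_distrib, neg_eq_zero]
        rw [key j hj j hj, h1s j hj, dl_sq, ← Finset.sum_add_distrib, Finset.sum_eq_zero]
        · simp
        · intro i _; exact dl_anti _ _ _ _)
      (fun j hj j' hj' => by
        simp only [map_neg, Finset.sum_neg_distrib]
        rw [← neg_add, neg_eq_zero, key j hj j' hj', key j' hj' j hj]
        have e1 := h2s j hj j' hj'
        have e2 : ∑ i ∈ range q, dl n (i + j) (dl n (q + j') (c i)) +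
            ∑ i ∈ range q, dl n (q + j') (dl n (i + j) (c i)) = 0 := by
          rw [← Finset.sum_add_distrib, Finset.sum_eq_zero]
          intro i _; exact dl_anti _ _ _ _
        have e3 : ∑ i ∈ range q, dl n (q + j) (dl n (i + j') (c i)) +
            ∑ i ∈ range q, dl n (i + j') (dl n (q + j) (c i)) = 0 := by
          rw [← Finset.sum_add_distrib, Finset.sum_eq_zero]
          intro i _; exact dl_anti _ _ _ _
        have e4 := dl_anti n (q + j) (q + j') (c q)
        have : (0 : XExt M n) = (0 + 0) + (0 + 0) := by simp
        rw [this]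
        nth_rewrite 1 [← e1]
        nth_rewrite 1 [← e2]
        nth_rewrite 1 [← e3]
        nth_rewrite 1 [← e4]
        abel)
    set V : ℕ → ℕ → XExt M n :=
      fun i i' => if i = q then c i' else if i' = q then c i else v i i' with hV
    have Vs : ∀ i i', V i i' = V i' i := by
      intro i i'
      simp only [hV]
      by_cases h : i = q <;> by_cases h' : i' = q <;> simp [h, h', vs i i']
    have Vq : ∀ i, V i q = c i := by
      intro i; rw [Vs]; simp [hV]
    have Vb : ∀ i < q + 1, ∀ j < r + 1,
        b i j = - ∑ i' ∈ range (q + 1), dl n (i' + j) (V i i') := by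
      intro i hi j hj
      by_cases hiq : i = q
      · subst hiq
        rw [hF' j hj]
        simp [hV]
      · have := vw i (by omega) j hj
        rw [Finset.sum_range_succ, Vq]
        have e : ∑ x ∈ range q, dl n (x + j) (V i x) = ∑ i' ∈ range q, dl n (i' + j) (v i i') := by
          apply Finset.sum_congr rfl
          intro x hx
          have := Finset.mem_range.1 hx
          simp only [hV]
          rw [if_neg hiq, if_neg (by omega)]
        rw [e, ← this]
        abel
    refine ⟨fun i i' => inl (u1 i i') + inr (V i i'), fun i i' => by dsimp only; rw [u1s, Vs], ?_, ?_⟩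
    · intro i hi i' hi'
      refine ⟨?_, ?_⟩
      · rw [map_add, fst_inl, fst_inr, add_zero]; exact u1d i hi i' hi'
      · rw [map_add, snd_inl, snd_inr, zero_add]
        simp only [hV]
        split_ifs with h h'
        · exact hcd i' hi'
        · exact hcd i hi
        · exact vd i (by omega) i' (by omega)
    · intro i hi j hj
      apply ext'
      · rw [map_sum]
        simp only [fst_dl, fst_mk, snd_mk, Finset.sum_add_distrib]
        rw [hif j hj (fun i' => V i i'), Vq]
        by_cases hjr : j = r
        · subst hjr
          rw [if_pos rfl]
          exact (har i).trans (add_comm _ _)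
        · rw [if_neg hjr, add_zero]
          exact u1w i hi j (by omega)
      · rw [map_sum]
        simp only [snd_dl, snd_mk, Finset.sum_neg_distrib]
        exact Vb i hi j hj

end XExt


namespace XExt
variable {M : Type} [AddCommGroup M] {N : Type} [AddCommGroup N]

/-- degree zero elements -/
def iot : (n : ℕ) → M →+ XExt M n
  | 0 => of0
  | n + 1 => inl.comp (iot n)

lemma iot_inj : ∀ (n : ℕ) (x : M), iot n x = 0 → x = 0
  | 0, _, h => h
  | n + 1, x, h => iot_inj n x (by
      have := congrArg fst h
      rw [map_zero] at this
      exact this)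

lemma iot_deg : ∀ (n : ℕ) (x : M), IsDeg n 0 (iot n x)
  | 0, _ => trivial
  | n + 1, x => ⟨iot_deg n x, rfl⟩

lemma exists_iot : ∀ (n : ℕ) (x : XExt M n), IsDeg n 0 x → ∃ t, x = iot n t
  | 0, x, _ => ⟨to0 x, rfl⟩
  | n + 1, x, h => by
    obtain ⟨t, ht⟩ := exists_iot n (fst x) h.1
    exact ⟨t, ext' ht h.2⟩

/-- functoriality -/
def mp (f : M →+ N) : (n : ℕ) → XExt M n →+ XExt N n
  | 0 => of0.comp (f.comp to0)
  | n + 1 => inl.comp ((mp f n).comp fst) + inr.comp ((mp f n).comp snd)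

lemma fst_mp (f : M →+ N) (n : ℕ) (x : XExt M (n + 1)) : fst (mp f (n + 1) x) = mp f n (fst x) :=
  fst_mk _ _
lemma snd_mp (f : M →+ N) (n : ℕ) (x : XExt M (n + 1)) : snd (mp f (n + 1) x) = mp f n (snd x) :=
  snd_mk _ _

lemma mp_iot (f : M →+ N) : ∀ (n : ℕ) (x : M), mp f n (iot n x) = iot n (f x)
  | 0, _ => rfl
  | n + 1, x => by
    apply ext'
    · rw [fst_mp]; exact mp_iot f n x
    · rw [snd_mp]; exact map_zero _

lemma mp_dl (f : M →+ N) : ∀ (n k : ℕ) (x : XExt M n), mp f n (dl n k x) = dl n k (mp f n x)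
  | 0, k, x => map_zero _
  | n + 1, k, x => by
    apply ext'
    · rw [fst_mp, fst_dl, fst_dl, map_add, mp_dl f n, fst_mp, snd_mp]
      congr 1
      split_ifs
      · rfl
      · exact map_zero _
    · rw [snd_mp, snd_dl, snd_dl, map_neg, mp_dl f n, snd_mp]

lemma mp_deg (f : M →+ N) : ∀ (n p : ℕ) (x : XExt M n), IsDeg n p x → IsDeg n p (mp f n x)
  | 0, 0, _, _ => trivial
  | 0, _ + 1, x, h => by
    have h : x = 0 := h
    rw [h, map_zero]; exact IsDeg.zero _ _
  | n + 1, 0, x, h => ⟨by rw [fst_mp]; exact mp_deg f _ _ _ h.1, by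
      rw [snd_mp, h.2, map_zero]⟩
  | n + 1, p + 1, x, h => ⟨by rw [fst_mp]; exact mp_deg f _ _ _ h.1, by
      rw [snd_mp]; exact mp_deg f _ _ _ h.2⟩

section psi
variable (n : ℕ) (ξ : ℕ → M →+ N)

def psi : XExt M n →+ XExt N n := ∑ k ∈ range n, (mp (ξ k) n).comp (dl n k)

lemma psi_apply (x : XExt M n) : psi n ξ x = ∑ k ∈ range n, mp (ξ k) n (dl n k x) := by
  simp [psi]

lemma dl_psi (l : ℕ) (x : XExt M n) : dl n l (psi n ξ x) = - psi n ξ (dl n l x) := by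
  rw [psi_apply, psi_apply, map_sum, ← Finset.sum_neg_distrib]
  apply Finset.sum_congr rfl
  intro k _
  rw [← mp_dl, dl_anti', map_neg]

lemma psi_deg (p : ℕ) (x : XExt M n) (h : IsDeg n (p + 1) x) : IsDeg n p (psi n ξ x) := by
  rw [psi_apply]
  exact IsDeg.sum _ _ fun k _ => mp_deg _ _ _ _ (h.dl k)

end psi
end XExt

open XExt

section TT
variable (T : ℕ → Type) [∀ i, AddCommGroup (T i)] (D : ∀ i, ℕ → T (i + 1) →+ T i)

def temb : (m i : ℕ) → T i →+ XExt (T 0) m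
  | 0, 0 => of0
  | 0, _ + 1 => 0
  | m + 1, 0 => inl.comp (temb m 0)
  | m + 1, i + 1 => inl.comp (temb m (i + 1)) + inr.comp ((temb m i).comp (D i m))

lemma fst_temb (m i : ℕ) (w : T i) : fst (temb T D (m + 1) i w) = temb T D m i w := by
  rcases i with _ | i
  · rfl
  · exact fst_mk _ _

lemma snd_temb0 (m : ℕ) (w : T 0) : snd (temb T D (m + 1) 0 w) = 0 := rfl

lemma snd_temb (m i : ℕ) (w : T (i + 1)) :
    snd (temb T D (m + 1) (i + 1) w) = temb T D m i (D i m w) := snd_mk _ _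

lemma temb_deg : ∀ (m i : ℕ) (w : T i), IsDeg m i (temb T D m i w)
  | 0, 0, _ => trivial
  | 0, _ + 1, _ => rfl
  | m + 1, 0, w => ⟨by rw [fst_temb]; exact temb_deg _ _ _, rfl⟩
  | m + 1, i + 1, w => ⟨by rw [fst_temb]; exact temb_deg _ _ _, by
      rw [snd_temb]; exact temb_deg _ _ _⟩

lemma temb_zero : ∀ (m : ℕ) (w : T 0), temb T D m 0 w = iot m w
  | 0, _ => rfl
  | m + 1, w => by
    apply XExt.ext'
    · rw [fst_temb, temb_zero m]; rfl
    · rfl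


lemma dl_temb (hsq : ∀ i k (w : T (i + 2)), D i k (D (i + 1) k w) = 0)
  (hanti : ∀ i k l (w : T (i + 2)), D i k (D (i + 1) l w) + D i l (D (i + 1) k w) = 0) : ∀ (m i k : ℕ), k < m → ∀ (w : T (i + 1)),
    dl m k (temb T D m (i + 1) w) = temb T D m i (D i k w) := by
  intro m
  induction m with
  | zero => intro i k hk; omega
  | succ m ih =>
    intro i k hk w
    by_cases h : k = m
    · subst h
      apply XExt.ext'
      · rw [fst_dl, dl_ge _ _ le_rfl, if_pos rfl, zero_add, snd_temb, fst_temb]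
      · rw [snd_dl, dl_ge _ _ le_rfl, neg_zero]
        rcases i with _ | i
        · rfl
        · rw [snd_temb, hsq, map_zero]
    · have hk' : k < m := by omega
      apply XExt.ext'
      · rw [fst_dl, if_neg h, add_zero, fst_temb, fst_temb, ih _ _ hk']
      · rw [snd_dl, snd_temb]
        rcases i with _ | i
        · rw [temb_zero, (iot_deg _ _).dl0, neg_zero]; rfl
        · rw [ih _ _ hk', snd_temb, ← map_neg]
          congr 1
          rw [neg_eq_iff_add_eq_zero]
          exact hanti i k m w


lemma temb_inj (hsq : ∀ i k (w : T (i + 2)), D i k (D (i + 1) k w) = 0)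
  (hanti : ∀ i k l (w : T (i + 2)), D i k (D (i + 1) l w) + D i l (D (i + 1) k w) = 0)
  (n : ℕ) (ha : ∀ i (w : T (i + 1)), (∀ k < n, D i k w = 0) → w = 0) : ∀ (i : ℕ) (w : T i), temb T D n i w = 0 → w = 0 := by
  intro i
  induction i with
  | zero => intro w h; rw [temb_zero] at h; exact iot_inj _ _ h
  | succ i ih =>
    intro w h
    apply ha
    intro k hk
    apply ih
    rw [← dl_temb T D hsq hanti n i k hk w, h, map_zero]

lemma T_eq_zero_of_gt (hsq : ∀ i k (w : T (i + 2)), D i k (D (i + 1) k w) = 0)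
  (hanti : ∀ i k l (w : T (i + 2)), D i k (D (i + 1) l w) + D i l (D (i + 1) k w) = 0)
  (n : ℕ) (ha : ∀ i (w : T (i + 1)), (∀ k < n, D i k w = 0) → w = 0) (i : ℕ) (hi : n < i) (w : T i) : w = 0 :=
  temb_inj T D hsq hanti n ha i w ((temb_deg T D n i w).gt hi)


theorem T_inj (hsq : ∀ i k (w : T (i + 2)), D i k (D (i + 1) k w) = 0)
  (hanti : ∀ i k l (w : T (i + 2)), D i k (D (i + 1) l w) + D i l (D (i + 1) k w) = 0)
  (n : ℕ) (ha : ∀ i (w : T (i + 1)), (∀ k < n, D i k w = 0) → w = 0)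
  (hb : ∀ i (z : ℕ → T (i + 1)), (∀ k < n, D i k (z k) = 0) →
  (∀ k < n, ∀ l < n, D i k (z l) + D i l (z k) = 0) → ∃ u : T (i + 2), ∀ k < n, D (i + 1) k u = z k)
    (p m : ℕ) (hpm : n + 1 = p + 1 + m) (hvan : ∀ u : T (p + 2), u = 0)
    (w : ℕ → ℕ → T (p + 1))
    (h1 : ∀ j < m, ∑ i ∈ range (p + 1), D p (i + j) (w i j) = 0)
    (h2 : ∀ j < m, ∀ j' < m, ∑ i ∈ range (p + 1), D p (i + j) (w i j') +
      ∑ i ∈ range (p + 1), D p (i + j') (w i j) = 0) :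
    ∀ i < p + 1, ∀ j < m, w i j = 0 := by
  classical
  let δ : T 1 →+ (Fin n → T 0) := AddMonoidHom.pi fun k : Fin n => D 0 k
  let N := (Fin n → T 0) ⧸ δ.range
  let ξ : ℕ → T 0 →+ N := fun k =>
    if h : k < n then (QuotientAddGroup.mk' δ.range).comp
      (AddMonoidHom.single (fun _ : Fin n => T 0) ⟨k, h⟩) else 0
  have hξ : ∀ t : ℕ → T 0, ∑ k ∈ range n, ξ k (t k) =
      QuotientAddGroup.mk' δ.range (fun k : Fin n => t k) := by
    intro t
    rw [Finset.sum_range]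
    have : (fun k : Fin n => t k) = ∑ k : Fin n, Pi.single k (t k) :=
      (Finset.univ_sum_single _).symm
    rw [this, map_sum]
    apply Finset.sum_congr rfl
    intro k _
    simp [ξ]
  have hdl := dl_temb T D hsq hanti n
  have hinj := temb_inj T D hsq hanti n ha
  have base : ∀ (u : XExt (T 0) n) (t : ℕ → T 0), (∀ k < n, dl n k u = iot n (t k)) →
      psi n ξ u = iot n (QuotientAddGroup.mk' δ.range (fun k : Fin n => t k)) := by
    intro u t ht
    rw [psi_apply, ← hξ, map_sum]
    apply Finset.sum_congr rfl
    intro k hk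
    rw [ht k (Finset.mem_range.1 hk), mp_iot]
  have hZ : ∀ i (w : T (i + 1)), psi n ξ (temb T D n (i + 1) w) = 0 := by
    intro i
    induction i with
    | zero =>
      intro w
      rw [base _ (fun k => D 0 k w)]
      · have : QuotientAddGroup.mk' δ.range (fun k : Fin n => D 0 k w) = 0 := by
          rw [QuotientAddGroup.mk'_apply, QuotientAddGroup.eq_zero_iff]
          exact ⟨w, rfl⟩
        rw [this, map_zero]
      · intro k hk
        rw [hdl 0 k hk, temb_zero]
    | succ i ih =>
      intro w
      apply (psi_deg n ξ (i + 1) _ (temb_deg T D n _ w)).sep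
      intro k hk
      rw [dl_psi, hdl _ k hk, ih, neg_zero]
  have hK : ∀ i (u : XExt (T 0) n), IsDeg n (i + 1) u → psi n ξ u = 0 →
      ∃ w : T (i + 1), u = temb T D n (i + 1) w := by
    intro i
    induction i with
    | zero =>
      intro u hu hpu
      choose t ht using fun k => exists_iot n (dl n k u) (hu.dl k)
      rw [base u t (fun k _ => ht k)] at hpu
      have := iot_inj _ _ hpu
      rw [QuotientAddGroup.mk'_apply, QuotientAddGroup.eq_zero_iff] at this
      obtain ⟨w, hw⟩ := this
      refine ⟨w, ?_⟩
      rw [← sub_eq_zero]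
      apply (hu.sub (temb_deg T D n 1 w)).sep
      intro k hk
      rw [map_sub, hdl 0 k hk, temb_zero, ht k, sub_eq_zero]
      congr 1
      exact (congrFun hw ⟨k, hk⟩).symm
    | succ i ih =>
      intro u hu hpu
      have : ∀ k, ∃ w : T (i + 1), dl n k u = temb T D n (i + 1) w := by
        intro k
        apply ih _ (hu.dl k)
        rw [← neg_eq_zero, ← dl_psi, hpu, map_zero]
      choose z hz using this
      obtain ⟨w, hw⟩ := hb i z
        (fun k hk => hinj _ _ (by rw [← hdl i k hk, ← hz, dl_sq]))
        (fun k hk l hl => hinj _ _ (by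
          rw [map_add, ← hdl i k hk, ← hdl i l hl, ← hz, ← hz, dl_anti]))
      refine ⟨w, ?_⟩
      rw [← sub_eq_zero]
      apply (hu.sub (temb_deg T D n _ w)).sep
      intro k hk
      rw [map_sub, hdl _ k hk, hz k, hw k hk, sub_self]
  have hW : ∀ j < m, ∀ f : ℕ → T (p + 1), ∑ i ∈ range (p + 1), dl n (i + j) (temb T D n (p + 1) (f i)) =
      temb T D n p (∑ i ∈ range (p + 1), D p (i + j) (f i)) := by
    intro j hj f
    rw [map_sum]
    apply Finset.sum_congr rfl
    intro i hi
    rw [Finset.mem_range] at hi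
    rw [hdl p _ (by omega)]
  obtain ⟨u, us, ud, uw⟩ := lemmaB n (p + 1) m hpm (fun i j => temb T D n (p + 1) (w i j))
    (fun i _ j _ => temb_deg _ _ _ _ _)
    (fun j hj => by rw [hW j hj (fun i => w i j), h1 j hj, map_zero])
    (fun j hj j' hj' => by
      rw [hW j hj (fun i => w i j'), hW j' hj' (fun i => w i j), ← map_add, h2 j hj j' hj', map_zero])
  have hu0 : ∀ i < p + 1, ∀ i' < p + 1, u i i' = 0 := by
    intro i hi i' hi'
    have hps : psi n ξ (u i i') = 0 := by
      apply lemmaA n (p + 1) m hpm (fun i' => psi n ξ (u i i'))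
        (fun i' hi' => psi_deg n ξ _ _ (ud i hi i' hi')) _ i' hi'
      intro j hj
      have := congrArg (psi n ξ) (uw i hi j hj)
      rw [hZ, map_sum] at this
      simp only [dl_psi, Finset.sum_neg_distrib]
      rw [← this, neg_zero]
    obtain ⟨v, hv⟩ := hK (p + 1) _ (ud i hi i' hi') hps
    rw [hv, hvan v, map_zero]
  intro i hi j hj
  apply hinj
  rw [uw i hi j hj]
  apply Finset.sum_eq_zero
  intro i' hi'
  rw [hu0 i hi i' (Finset.mem_range.1 hi'), map_zero]

end TT


open scoped Matrix

namespace Red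

/-- exactness of a pair of matrices -/
def Ex {A : Type*} [CommRing A] {a b c : ℕ} (d1 : Matrix (Fin a) (Fin b) A)
    (d2 : Matrix (Fin b) (Fin c) A) : Prop :=
  ∀ z, d1 *ᵥ z = 0 → ∃ v, d2 *ᵥ v = z

/-- `y` is regular on the cokernel of `d` -/
def Reg {A : Type*} [CommRing A] {a b : ℕ} (y : A) (d : Matrix (Fin a) (Fin b) A) : Prop :=
  ∀ w v, y • w = d *ᵥ v → ∃ v', w = d *ᵥ v'

theorem map_mulVec' {A B : Type*} [CommRing A] [CommRing B] (ψ : A →+* B) {a b : ℕ}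
    (d : Matrix (Fin a) (Fin b) A) (v : Fin b → A) :
    (d.map ψ) *ᵥ (fun q => ψ (v q)) = fun p => ψ ((d *ᵥ v) p) := by
  funext p
  simp [Matrix.mulVec, dotProduct, map_sum]

theorem lemmaMod {A B : Type*} [CommRing A] [CommRing B] (ψ : A →+* B)
    (hs : Function.Surjective ψ) (y : A) (hy : ψ y = 0) (hk : ∀ f, ψ f = 0 → ∃ g, f = y * g)
    {a b c : ℕ} (d1 : Matrix (Fin a) (Fin b) A) (d2 : Matrix (Fin b) (Fin c) A)
    (hex : Ex d1 d2) (hreg : Reg y d1) : Ex (d1.map ψ) (d2.map ψ) := by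
  intro z hz
  choose z' hz' using fun q => hs (z q)
  have h1 : ∀ p, ψ ((d1 *ᵥ z') p) = 0 := by
    intro p
    have := congrFun (map_mulVec' ψ d1 z') p
    simp only [hz'] at this
    rw [← this]; exact congrFun hz p
  choose w hw using fun p => hk _ (h1 p)
  obtain ⟨v', hv'⟩ := hreg w z' (by funext p; simp [hw p])
  have h2 : d1 *ᵥ (z' - y • v') = 0 := by
    rw [Matrix.mulVec_sub, Matrix.mulVec_smul, ← hv']
    funext p; simp [hw p]
  obtain ⟨v, hv⟩ := hex _ h2
  refine ⟨fun q => ψ (v q), ?_⟩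
  rw [map_mulVec', hv]
  funext p
  simp [hy, hz']

theorem reg_of_exact {A : Type*} [CommRing A] [IsDomain A] (y : A) (hy : y ≠ 0) {a b c : ℕ}
    (d0 : Matrix (Fin a) (Fin b) A) (d1 : Matrix (Fin b) (Fin c) A)
    (hc : d0 * d1 = 0) (hex : Ex d0 d1) : Reg y d1 := by
  intro w v h
  have h1 : d0 *ᵥ (y • w) = 0 := by rw [h, Matrix.mulVec_mulVec, hc, Matrix.zero_mulVec]
  rw [Matrix.mulVec_smul] at h1
  have h2 : d0 *ᵥ w = 0 := (smul_eq_zero.mp h1).resolve_left hy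
  obtain ⟨v', hv'⟩ := hex w h2
  exact ⟨v', hv'.symm⟩

/-- kill the first variable -/
noncomputable def psi0 (R : Type*) [CommRing R] (n : ℕ) :
    MvPolynomial (Fin (n+1)) R →+* MvPolynomial (Fin n) R :=
  eval₂Hom C (Fin.cons 0 X)

theorem psi0_X0 (R : Type*) [CommRing R] (n : ℕ) : psi0 R n (X 0) = 0 := by simp [psi0]

theorem psi0_Xs (R : Type*) [CommRing R] (n : ℕ) (k : Fin n) : psi0 R n (X k.succ) = X k := by
  simp [psi0]

theorem psi0_sec (R : Type*) [CommRing R] (n : ℕ) (f : MvPolynomial (Fin n) R) :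
    psi0 R n (rename Fin.succ f) = f := by
  induction f using MvPolynomial.induction_on with
  | C a => simp [psi0]
  | add p q hp hq => simp [hp, hq]
  | mul_X p k hp => simp [hp, psi0_Xs]

theorem ker_of_sec {A B : Type*} [CommRing A] [CommRing B] (ψ : A →+* B) (σ : B →+* A) (y : A)
    (h : (Ideal.Quotient.mk (Ideal.span {y})) =
      (Ideal.Quotient.mk (Ideal.span {y})).comp (σ.comp ψ)) (f : A) (hf : ψ f = 0) :
    ∃ g, f = y * g := by
  have h1 := RingHom.congr_fun h f
  simp only [RingHom.comp_apply, hf, map_zero] at h1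
  rw [Ideal.Quotient.eq_zero_iff_mem, Ideal.mem_span_singleton] at h1
  exact h1

theorem psi0_ker (R : Type*) [CommRing R] (n : ℕ) (f : MvPolynomial (Fin (n+1)) R)
    (hf : psi0 R n f = 0) : ∃ g, f = X 0 * g := by
  refine ker_of_sec (psi0 R n) (rename Fin.succ : _ →ₐ[R] _).toRingHom (X 0) ?_ f hf
  apply MvPolynomial.ringHom_ext
  · intro r; simp [psi0]
  · intro i
    refine Fin.cases ?_ (fun k => ?_) i
    · simp only [RingHom.comp_apply, psi0_X0, map_zero]
      rw [Ideal.Quotient.eq_zero_iff_mem]; exact Ideal.mem_span_singleton_self _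
    · simp [psi0_Xs]

theorem depth_lemma (R : Type*) [CommRing R] [IsDomain R] (n : ℕ) : ∀ (rk : ℕ → ℕ)
    (dd : (i : ℕ) → Matrix (Fin (rk i)) (Fin (rk (i+1))) (MvPolynomial (Fin n) R)),
    (∀ i, dd i * dd (i+1) = 0) → (∀ i, Ex (dd i) (dd (i+1))) → (∀ i, n ≤ i → rk i = 0) →
    ∀ f : Fin (rk 0) → MvPolynomial (Fin n) R,
      (∀ k : Fin n, ∃ v, (X k : MvPolynomial (Fin n) R) • f = dd 0 *ᵥ v) →
      ∃ v, f = dd 0 *ᵥ v := by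
  induction n with
  | zero =>
    intro rk dd hc he hr f hf
    refine ⟨0, ?_⟩
    funext p
    exact absurd p.2 (by simp [hr 0 le_rfl])
  | succ n ih =>
    intro rk dd hc he hr f hf
    obtain ⟨g0, hg0⟩ := hf 0
    choose g hg using fun k : Fin n => hf k.succ
    have hX : (X 0 : MvPolynomial (Fin (n+1)) R) ≠ 0 := X_ne_zero 0
    have key := ih (fun i => rk (i+1)) (fun i => (dd (i+1)).map (psi0 R n))
      (fun i => by
        rw [← Matrix.map_mul, hc (i+1)]; ext; simp)
      (fun i => lemmaMod (psi0 R n) (fun f => ⟨_, psi0_sec R n f⟩) (X 0) (psi0_X0 R n)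
        (psi0_ker R n) _ _ (he (i+1)) (reg_of_exact _ hX _ _ (hc i) (he i)))
      (fun i hi => hr (i+1) (by omega)) (fun p => psi0 R n (g0 p))
      (fun k => by
        have h1 : dd 0 *ᵥ ((X k.succ : MvPolynomial (Fin (n+1)) R) • g0 -
            (X 0 : MvPolynomial (Fin (n+1)) R) • g k) = 0 := by
          rw [Matrix.mulVec_sub, Matrix.mulVec_smul, Matrix.mulVec_smul, ← hg0, ← hg,
            smul_smul, smul_smul, mul_comm, sub_self]
        obtain ⟨h, hh⟩ := he 0 _ h1
        refine ⟨fun q => psi0 R n (h q), ?_⟩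
        rw [map_mulVec', hh]
        funext p
        simp [psi0_X0, psi0_Xs])
    obtain ⟨h', hh'⟩ := key
    have h2 : ∃ h : Fin (rk 2) → MvPolynomial (Fin (n+1)) R, ∀ q, psi0 R n (h q) = h' q :=
      ⟨_, fun q => psi0_sec R n (h' q)⟩
    obtain ⟨h, hh⟩ := h2
    have h3 : ∀ p, psi0 R n ((g0 - dd 1 *ᵥ h) p) = 0 := by
      intro p
      have e1 := congrFun (map_mulVec' (psi0 R n) (dd 1) h) p
      have e2 := congrFun hh' p
      simp only [hh] at e1
      simp only [Pi.sub_apply, map_sub]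
      rw [← e1, sub_eq_zero]
      exact e2
    choose e he' using fun p => psi0_ker R n _ (h3 p)
    refine ⟨e, ?_⟩
    have h4 : g0 = dd 1 *ᵥ h + (X 0 : MvPolynomial (Fin (n+1)) R) • e := by
      funext p
      have := he' p
      simp only [Pi.sub_apply] at this
      simp only [Pi.add_apply, Pi.smul_apply, smul_eq_mul, ← this]; ring
    rw [h4, Matrix.mulVec_add, Matrix.mulVec_mulVec, hc 0, Matrix.zero_mulVec, zero_add,
      Matrix.mulVec_smul] at hg0
    exact smul_right_injective _ hX hg0

theorem mccoy {A M : Type*} [CommRing A] [AddCommGroup M] [Module A M] (x : ℕ → A) (n : ℕ)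
    (hx : ∀ k, n < k → x k = 0) (ha : ∀ m : M, (∀ k, x k • m = 0) → m = 0) (N : ℕ) :
    ∀ g : ℕ → M, (∀ j, N ≤ j → g j = 0) →
    (∀ s, ∑ q ∈ antidiagonal s, x q.1 • g q.2 = 0) → ∀ j, g j = 0 := by
  induction N with
  | zero => intro g hg _ j; exact hg j (Nat.zero_le _)
  | succ N ih =>
    intro g hg hs
    have step : ∀ k, (∀ k', k < k' → ∀ j, x k' • g j = 0) → ∀ j, x k • g j = 0 := by
      intro k hk
      have h1 : x k • g N = 0 := by
        rw [← hs (k+N)]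
        symm
        refine Finset.sum_eq_single (k, N) ?_ (by simp)
        rintro ⟨a, b⟩ hab hne
        simp only [HasAntidiagonal.mem_antidiagonal] at hab
        rcases lt_trichotomy a k with h | h | h
        · simp [hg b (by omega)]
        · exact absurd (by ext <;> simp <;> omega) hne
        · exact hk a h b
      apply ih (fun j => x k • g j)
      · intro j hj
        rcases Nat.eq_or_lt_of_le hj with h | h
        · rw [← h]; exact h1
        · simp [hg j h]
      · intro s
        have := congrArg (x k • ·) (hs s)
        simp only [smul_zero, Finset.smul_sum] at this
        rw [← this]
        exact Finset.sum_congr rfl fun q _ => smul_comm _ _ _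
    have all : ∀ t k, n < k + t → ∀ j, x k • g j = 0 := by
      intro t
      induction t with
      | zero => intro k hk j; simp [hx k hk]
      | succ t iht => intro k hk; exact step k fun k' hk' => iht k' (by omega)
    intro j
    exact ha _ fun k => all (n+1) k (by omega) j

theorem coeff_mulVec {A : Type*} [CommRing A] {a b : ℕ} (d : Matrix (Fin a) (Fin b) A)
    (v : Fin b → Polynomial A) (j : ℕ) (p : Fin a) :
    ((d.map Polynomial.C *ᵥ v) p).coeff j = (d *ᵥ (fun q => (v q).coeff j)) p := by
  simp [Matrix.mulVec, dotProduct, Polynomial.finsetSum_coeff]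

theorem assemble {A : Type*} [CommRing A] {a b : ℕ} (d : Matrix (Fin a) (Fin b) A)
    (z : Fin a → Polynomial A) (h : ∀ j, ∃ v, d *ᵥ v = fun p => (z p).coeff j) :
    ∃ V, d.map Polynomial.C *ᵥ V = z := by
  choose v hv using h
  let N := (Finset.univ.sup fun p => (z p).natDegree) + 1
  have hN : ∀ j, N ≤ j → ∀ p, (z p).coeff j = 0 := by
    intro j hj p
    apply Polynomial.coeff_eq_zero_of_natDegree_lt
    have : (z p).natDegree ≤ Finset.univ.sup fun p => (z p).natDegree :=
      Finset.le_sup (f := fun p => (z p).natDegree) (mem_univ p)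
    omega
  refine ⟨fun q => ∑ j ∈ range N, Polynomial.monomial j (v j q), ?_⟩
  funext p
  ext j
  rw [coeff_mulVec]
  simp only [Polynomial.finsetSum_coeff, Polynomial.coeff_monomial, Finset.sum_ite_eq',
    mem_range]
  by_cases hj : j < N
  · simp only [hj, if_true]; exact congrFun (hv j) p
  · simp only [hj, if_false]
    rw [hN j (by omega) p]
    simp [Matrix.mulVec, dotProduct]

theorem ex_poly {A : Type*} [CommRing A] {a b c : ℕ} (d1 : Matrix (Fin a) (Fin b) A)
    (d2 : Matrix (Fin b) (Fin c) A) (hex : Ex d1 d2) :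
    Ex (d1.map (Polynomial.C : A →+* Polynomial A)) (d2.map (Polynomial.C : A →+* Polynomial A)) := by
  intro z hz
  apply assemble
  intro j
  apply hex
  funext p
  rw [← coeff_mulVec]
  exact (congrArg (Polynomial.coeff · j) (congrFun hz p))

theorem reg_poly {A : Type*} [CommRing A] {a b : ℕ} (d : Matrix (Fin a) (Fin b) A) (n : ℕ)
    (x : Fin (n+1) → A) (ha : ∀ f, (∀ k, ∃ v, x k • f = d *ᵥ v) → ∃ v, f = d *ᵥ v) :
    Reg (∑ k : Fin (n+1), Polynomial.X ^ (k : ℕ) * Polynomial.C (x k))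
      (d.map (Polynomial.C : A →+* Polynomial A)) := by
  intro w v h
  let P := LinearMap.range d.mulVecLin
  have hP : ∀ f, f ∈ P ↔ ∃ v, f = d *ᵥ v := by
    intro f
    constructor
    · rintro ⟨v, rfl⟩; exact ⟨v, rfl⟩
    · rintro ⟨v, rfl⟩; exact ⟨v, rfl⟩
  let x' : ℕ → A := fun k => if hk : k < n + 1 then x ⟨k, hk⟩ else 0
  let N := (Finset.univ.sup fun p => (w p).natDegree) + 1
  have hN : ∀ j, N ≤ j → ∀ p, (w p).coeff j = 0 := by
    intro j hj p
    apply Polynomial.coeff_eq_zero_of_natDegree_lt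
    have : (w p).natDegree ≤ Finset.univ.sup fun p => (w p).natDegree :=
      Finset.le_sup (f := fun p => (w p).natDegree) (mem_univ p)
    omega
  have hy : ∀ k, (∑ k : Fin (n+1), Polynomial.X ^ (k : ℕ) * Polynomial.C (x k)).coeff k = x' k := by
    intro k
    simp only [Polynomial.finsetSum_coeff, Polynomial.coeff_mul_C, Polynomial.coeff_X_pow, x']
    split_ifs with hk
    · rw [Finset.sum_eq_single ⟨k, hk⟩]
      · simp
      · intro b _ hb
        have : k ≠ b := fun h => hb (by ext; exact h.symm)
        simp [this]
      · simp
    · apply Finset.sum_eq_zero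
      intro b _
      have : k ≠ b := by have := b.2; omega
      simp [this]
  have key := mccoy (M := (Fin a → A) ⧸ P) x' n (fun k hk => by simp [x']; omega)
    (by
      intro m
      induction m using Submodule.Quotient.induction_on with
      | _ f =>
      intro hm
      rw [Submodule.Quotient.mk_eq_zero, hP]
      apply ha
      intro k
      rw [← hP]
      have := hm k
      rw [← Submodule.Quotient.mk_smul, Submodule.Quotient.mk_eq_zero] at this
      have hk : (k : ℕ) ≤ n := by have := k.2; omega
      simpa [x', hk] using this)
    N (fun j => Submodule.Quotient.mk fun p => (w p).coeff j)
    (by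
      intro j hj
      rw [Submodule.Quotient.mk_eq_zero]
      have : (fun p => (w p).coeff j) = 0 := by funext p; exact hN j hj p
      rw [this]; exact P.zero_mem)
    (by
      intro s
      simp only [← Submodule.Quotient.mk_smul]
      have e := map_sum (Submodule.mkQ P) (fun q : ℕ × ℕ => x' q.1 • fun p => (w p).coeff q.2)
        (antidiagonal s)
      simp only [Submodule.mkQ_apply] at e
      rw [← e, Submodule.Quotient.mk_eq_zero, hP]
      refine ⟨fun q => (v q).coeff s, ?_⟩
      funext p
      rw [← coeff_mulVec]
      have := congrArg (Polynomial.coeff · s) (congrFun h p)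
      simp only [Pi.smul_apply, smul_eq_mul, Polynomial.coeff_mul, hy] at this
      erw [← this]
      simp)
  have := assemble d w (fun j => by
    have := key j
    rw [Submodule.Quotient.mk_eq_zero, hP] at this
    obtain ⟨v, hv⟩ := this
    exact ⟨v, hv.symm⟩)
  obtain ⟨V, hV⟩ := this
  exact ⟨V, hV.symm⟩

/-- minimal graded acyclic complexes over `R[x_1,…,x_n]` -/
def Good (R : Type) [CommRing R] (n : ℕ) (rk : ℕ → ℕ) (deg : (i : ℕ) → Fin (rk i) → ℤ)
    (dd : (i : ℕ) → Matrix (Fin (rk i)) (Fin (rk (i+1))) (MvPolynomial (Fin n) R)) : Prop :=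
  (∀ i, dd i * dd (i+1) = 0) ∧ (∀ i, Ex (dd i) (dd (i+1))) ∧
  (∀ i p q, dd i p q = 0 ∨ ∃ m : ℕ, deg (i+1) q = deg i p + ((m : ℤ) + 1) ∧
    (dd i p q).IsHomogeneous (m+1))

/-- substitution of the generic linear form -/
noncomputable def phi (R : Type) [CommRing R] (n : ℕ) :
    MvPolynomial (Fin (n+1)) R →+* MvPolynomial (Fin n) (Polynomial R) :=
  eval₂Hom (C.comp Polynomial.C)
    (Fin.cons (-∑ k : Fin n, C (Polynomial.X ^ ((k : ℕ) + 1)) * X k) X)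

theorem phi_X0 (R : Type) [CommRing R] (n : ℕ) :
    phi R n (X 0) = -∑ k : Fin n, C (Polynomial.X ^ ((k : ℕ) + 1)) * X k := by simp [phi]

theorem phi_Xs (R : Type) [CommRing R] (n : ℕ) (k : Fin n) : phi R n (X k.succ) = X k := by
  simp [phi]

theorem phi_C (R : Type) [CommRing R] (n : ℕ) (r : R) : phi R n (C r) = C (Polynomial.C r) := by
  simp [phi]

theorem phi_homog (R : Type) [CommRing R] (n m : ℕ) (f : MvPolynomial (Fin (n+1)) R)
    (hf : f.IsHomogeneous m) : (phi R n f).IsHomogeneous m := by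
  have := hf.eval₂ (C.comp Polynomial.C : R →+* MvPolynomial (Fin n) (Polynomial R))
    (Fin.cons (-∑ k : Fin n, C (Polynomial.X ^ ((k : ℕ) + 1)) * X k) X) (n := 1)
    (fun r => isHomogeneous_C _ _) (fun i => by
      refine Fin.cases ?_ (fun k => ?_) i
      · rw [Fin.cons_zero]
        refine IsHomogeneous.neg (IsHomogeneous.sum _ _ _ fun k _ => ?_)
        have := (isHomogeneous_C (Fin n) (Polynomial.X ^ ((k : ℕ) + 1) : Polynomial R)).mul
          (isHomogeneous_X (Polynomial R) k)
        simpa using this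
      · rw [Fin.cons_succ]; exact isHomogeneous_X _ _)
  simpa [phi] using this

/-- the extended quotient map -/
noncomputable def psi (R : Type) [CommRing R] (n : ℕ) :
    Polynomial (MvPolynomial (Fin (n+1)) R) →+* MvPolynomial (Fin n) (Polynomial R) :=
  Polynomial.eval₂RingHom (phi R n) (C Polynomial.X)

/-- its section -/
noncomputable def sec (R : Type) [CommRing R] (n : ℕ) :
    MvPolynomial (Fin n) (Polynomial R) →+* Polynomial (MvPolynomial (Fin (n+1)) R) :=
  eval₂Hom (Polynomial.mapRingHom C) (fun k => Polynomial.C (X k.succ))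

/-- the generic linear form -/
noncomputable def yy (R : Type) [CommRing R] (n : ℕ) : Polynomial (MvPolynomial (Fin (n+1)) R) :=
  ∑ k : Fin (n+1), Polynomial.X ^ (k : ℕ) * Polynomial.C (X k)

theorem psi_C (R : Type) [CommRing R] (n : ℕ) (f) : psi R n (Polynomial.C f) = phi R n f := by
  simp [psi]

theorem psi_X (R : Type) [CommRing R] (n : ℕ) : psi R n Polynomial.X = C Polynomial.X := by
  simp [psi]

theorem psi_yy (R : Type) [CommRing R] (n : ℕ) : psi R n (yy R n) = 0 := by
  rw [yy, Fin.sum_univ_succ]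
  simp only [map_add, map_sum, map_mul, map_pow, psi_C, psi_X, phi_X0, phi_Xs]
  simp

theorem psi_sec (R : Type) [CommRing R] (n : ℕ) (f) : psi R n (sec R n f) = f := by
  have : (psi R n).comp (sec R n) = RingHom.id _ := by
    apply MvPolynomial.ringHom_ext'
    · apply Polynomial.ringHom_ext
      · intro a; simp [sec, psi_C, phi_C]
      · simp [sec, psi_X]
    · intro k; simp [sec, psi_C, phi_Xs]
  exact RingHom.congr_fun this f

theorem psi_ker (R : Type) [CommRing R] (n : ℕ) (f) (hf : psi R n f = 0) :
    ∃ g, f = yy R n * g := by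
  refine ker_of_sec (psi R n) (sec R n) (yy R n) ?_ f hf
  apply Polynomial.ringHom_ext'
  · apply MvPolynomial.ringHom_ext
    · intro r; simp [psi_C, phi_C, sec]
    · intro i
      refine Fin.cases ?_ (fun k => ?_) i
      · simp only [RingHom.comp_apply, psi_C, phi_X0]
        rw [Ideal.Quotient.eq, Ideal.mem_span_singleton]
        refine ⟨1, ?_⟩
        rw [yy, Fin.sum_univ_succ]
        simp [sec]
      · simp [psi_C, phi_Xs, sec]
  · simp [psi_X, sec]

theorem yy_ne (R : Type) [CommRing R] [IsDomain R] (n : ℕ) : yy R n ≠ 0 := by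
  intro h
  have := congrArg (Polynomial.coeff · 0) h
  simp only [yy, Fin.sum_univ_succ] at this
  simp [Polynomial.finsetSum_coeff] at this

theorem good_step (R : Type) [CommRing R] [IsDomain R] (n : ℕ) (rk : ℕ → ℕ)
    (deg : (i : ℕ) → Fin (rk i) → ℤ)
    (dd : (i : ℕ) → Matrix (Fin (rk i)) (Fin (rk (i+1))) (MvPolynomial (Fin (n+1)) R))
    (h : Good R (n+1) rk deg dd) (hr : ∀ i, n + 1 ≤ i → rk i = 0) :
    Good (Polynomial R) n rk deg (fun i => (dd i).map (phi R n)) := by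
  obtain ⟨hc, he, hh⟩ := h
  have hmap : ∀ i, (dd i).map (phi R n) = ((dd i).map
      (Polynomial.C : _ →+* Polynomial (MvPolynomial (Fin (n+1)) R))).map (psi R n) := by
    intro i; ext p q; simp [psi_C]
  refine ⟨?_, ?_, ?_⟩
  · intro i
    rw [← Matrix.map_mul, hc i]; ext; simp
  · intro i
    simp only [hmap]
    refine lemmaMod (psi R n) (fun f => ⟨_, psi_sec R n f⟩) (yy R n) (psi_yy R n) (psi_ker R n)
      _ _ (ex_poly _ _ (he i)) ?_
    cases i with
    | zero =>
      exact reg_poly (dd 0) n X (depth_lemma R (n+1) rk dd hc he hr)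
    | succ i =>
      refine reg_of_exact _ (yy_ne R n) _ _ ?_ (ex_poly _ _ (he i))
      rw [← Matrix.map_mul, hc i]; ext; simp
  · intro i p q
    rcases hh i p q with h | ⟨m, h1, h2⟩
    · left; simp [h]
    · right; exact ⟨m, h1, by simpa using phi_homog R n (m+1) _ h2⟩

theorem good_reduce (c : ℕ) (rk : ℕ → ℕ) (deg : (i : ℕ) → Fin (rk i) → ℤ)
    (hr : ∀ i, c < i → rk i = 0) (n : ℕ) : ∀ (R : Type) [CommRing R] [IsDomain R]
    (dd : (i : ℕ) → Matrix (Fin (rk i)) (Fin (rk (i+1))) (MvPolynomial (Fin n) R)),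
    Good R n rk deg dd →
    ∃ (R' : Type) (_ : CommRing R') (_ : IsDomain R') (n' : ℕ) (_ : n' ≤ c)
      (dd' : (i : ℕ) → Matrix (Fin (rk i)) (Fin (rk (i+1))) (MvPolynomial (Fin n') R')),
      Good R' n' rk deg dd' := by
  induction n with
  | zero => intro R _ _ dd h; exact ⟨R, _, inferInstance, 0, Nat.zero_le _, dd, h⟩
  | succ n ih =>
    intro R _ _ dd h
    by_cases hn : n + 1 ≤ c
    · exact ⟨R, _, inferInstance, n+1, hn, dd, h⟩
    · exact ih (Polynomial R) _ (good_step R n rk deg dd h fun i hi => hr i (by omega))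

end Red


open scoped Matrix

namespace Red

section Lin
variable {R : Type} [CommRing R] {n : ℕ}

/-- the coefficient of `x_k` -/
noncomputable def lk (k : Fin n) (f : MvPolynomial (Fin n) R) : R := constantCoeff (pderiv k f)

theorem lk_zero (k : Fin n) : lk k (0 : MvPolynomial (Fin n) R) = 0 := by simp [lk]

theorem lk_sum (k : Fin n) {ι : Type*} (s : Finset ι) (f : ι → MvPolynomial (Fin n) R) :
    lk k (∑ i ∈ s, f i) = ∑ i ∈ s, lk k (f i) := by simp [lk]

theorem lk_mul (k : Fin n) (f g : MvPolynomial (Fin n) R) :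
    lk k (f * g) = lk k f * constantCoeff g + constantCoeff f * lk k g := by
  simp [lk, Derivation.leibniz]; ring

theorem lk_X_mul_C (k l : Fin n) (a : R) :
    lk k (X l * C a) = if k = l then a else 0 := by
  rw [lk_mul]
  by_cases h : k = l
  · subst h; simp [lk]
  · simp [lk, h, pderiv_X_of_ne (Ne.symm h)]

theorem cc_homog {f : MvPolynomial (Fin n) R} {m : ℕ} (hf : f.IsHomogeneous (m+1)) :
    constantCoeff f = 0 := by
  rw [constantCoeff_eq]
  exact hf.coeff_eq_zero (by simp)

theorem lk_homog {f : MvPolynomial (Fin n) R} {m : ℕ} (hf : f.IsHomogeneous (m+2)) (k : Fin n) :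
    lk k f = 0 := by
  have h := hf.pderiv (i := k)
  exact cc_homog (m := m) h

theorem lin_eq {f : MvPolynomial (Fin n) R} (hf : f.IsHomogeneous 1) :
    f = ∑ k, X k * C (lk k f) := by
  have h := hf.sum_X_mul_pderiv
  rw [one_smul] at h
  conv_lhs => rw [← h]
  refine Finset.sum_congr rfl fun k _ => ?_
  congr 1
  have h1 := hf.pderiv (i := k)
  have h2 := (totalDegree_zero_iff_isHomogeneous (Fin n)).mpr h1
  rw [totalDegree_eq_zero_iff_eq_C] at h2
  rw [h2]; simp [lk, constantCoeff_eq]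

theorem eval_lin {f : MvPolynomial (Fin n) R} (hf : f.IsHomogeneous 1) (t : Fin n → R) :
    eval t f = ∑ k, t k * lk k f := by
  conv_lhs => rw [lin_eq hf]
  simp

end Lin

theorem sum_sub {ι M : Type*} [Fintype ι] [AddCommMonoid M] (P : ι → Prop) [DecidablePred P]
    (f : ι → M) (h : ∀ i, ¬ P i → f i = 0) : ∑ i, f i = ∑ i : {i // P i}, f i.1 := by
  rw [← Finset.sum_filter_of_ne (p := P) (fun x _ hx => by by_contra hp; exact hx (h x hp))]
  exact Finset.sum_subtype _ (by simp) f

theorem sum_alt {ι M : Type*} [Fintype ι] [DecidableEq ι] [AddCommGroup M] (S : ι → ι → M)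
    (h0 : ∀ k, S k k = 0) (h1 : ∀ k l, S k l + S l k = 0) : ∑ k, ∑ l, S k l = 0 := by
  rw [← Fintype.sum_prod_type' S]
  refine Finset.sum_involution (fun x _ => x.swap) (fun x _ => h1 _ _) ?_ (by simp) (by simp)
  rintro ⟨a, b⟩ _ hne h
  simp only [Prod.swap_prod_mk, Prod.mk.injEq] at h
  exact hne (by rw [h.1]; exact h0 _)

section G
variable {R : Type} [CommRing R] {n : ℕ} {rk : ℕ → ℕ} {deg : (i : ℕ) → Fin (rk i) → ℤ}
  {dd : (i : ℕ) → Matrix (Fin (rk i)) (Fin (rk (i+1))) (MvPolynomial (Fin n) R)}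

theorem cc_entry (h : Good R n rk deg dd) (i p q) : constantCoeff (dd i p q) = 0 := by
  rcases h.2.2 i p q with h | ⟨m, _, h⟩
  · simp [h]
  · exact cc_homog h

theorem cc_mulVec (h : Good R n rk deg dd) (i v p) : constantCoeff ((dd i *ᵥ v) p) = 0 := by
  simp [Matrix.mulVec, dotProduct, cc_entry h]

theorem deg_ge [Nontrivial R] (h : Good R n rk deg dd) (hgen : ∀ p, 0 ≤ deg 0 p) (i : ℕ) :
    ∀ q, (i : ℤ) ≤ deg i q := by
  induction i with
  | zero => simpa using hgen
  | succ i ih =>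
    intro q
    by_cases hz : ∀ p, dd i p q = 0
    · exfalso
      obtain ⟨v, hv⟩ := h.2.1 i (Pi.single q 1) (by
        funext p; simp [hz])
      have := cc_mulVec h (i+1) v q
      rw [hv] at this
      simp at this
    · push Not at hz
      obtain ⟨p, hp⟩ := hz
      rcases h.2.2 i p q with h' | ⟨m, h', _⟩
      · exact absurd h' hp
      · have := ih p; push_cast; omega

theorem lin_entry (h : Good R n rk deg dd) (i p q)
    (hp : deg i p = i) (hq : deg (i+1) q = (i+1 : ℕ)) : (dd i p q).IsHomogeneous 1 := by
  rcases h.2.2 i p q with h' | ⟨m, h', hh⟩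
  · rw [h']; exact isHomogeneous_zero _ _ _
  · have : m = 0 := by push_cast at hq; omega
    subst this; exact hh

theorem zero_entry (h : Good R n rk deg dd) (hd : ∀ (i : ℕ) q, (i : ℤ) ≤ deg i q) (i p q)
    (hp : ¬ deg i p = i) (hq : deg (i+1) q = (i+1 : ℕ)) : dd i p q = 0 := by
  rcases h.2.2 i p q with h' | ⟨m, h', hh⟩
  · exact h'
  · have := hd i p; push_cast at hq; omega

theorem lk_entry (h : Good R n rk deg dd) (hd : ∀ (i : ℕ) q, (i : ℤ) ≤ deg i q) (i p q)
    (hp : deg i p = i) (hq : ¬ deg (i+1) q = (i+1 : ℕ)) (k) : lk k (dd i p q) = 0 := by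
  rcases h.2.2 i p q with h' | ⟨m, h', hh⟩
  · rw [h', lk_zero]
  · have := hd (i+1) q
    push_cast at hq this
    obtain ⟨m', rfl⟩ : ∃ m', m = m' + 1 := ⟨m - 1, by omega⟩
    exact lk_homog hh k

/-- generators of degree `i` in homological degree `i` -/
abbrev Tau (rk : ℕ → ℕ) (deg : (i : ℕ) → Fin (rk i) → ℤ) (i : ℕ) : Type :=
  {q : Fin (rk i) // deg i q = (i : ℕ)}

/-- linear part -/
noncomputable def NN (deg : (i : ℕ) → Fin (rk i) → ℤ)
  (dd : (i : ℕ) → Matrix (Fin (rk i)) (Fin (rk (i+1))) (MvPolynomial (Fin n) R)) (i k : ℕ) :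
    Matrix (Tau rk deg i) (Tau rk deg (i+1)) R :=
  fun p q => if hk : k < n then lk ⟨k, hk⟩ (dd i p.1 q.1) else 0

/-- evaluation of the linear part -/
noncomputable def NE (deg : (i : ℕ) → Fin (rk i) → ℤ)
  (dd : (i : ℕ) → Matrix (Fin (rk i)) (Fin (rk (i+1))) (MvPolynomial (Fin n) R)) (i : ℕ)
    (t : Fin n → R) : Matrix (Tau rk deg i) (Tau rk deg (i+1)) R :=
  fun p q => eval t (dd i p.1 q.1)

theorem NE_mul (h : Good R n rk deg dd) (hd : ∀ (i : ℕ) q, (i : ℤ) ≤ deg i q) (i t) :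
    NE deg dd i t * NE deg dd (i+1) t = 0 := by
  ext p r
  have := congrArg (eval t) (congrFun (congrFun (h.1 i) p.1) r.1)
  rw [Matrix.mul_apply, map_sum, sum_sub (fun q => deg (i+1) q = (i+1 : ℕ))] at this
  · simpa only [Matrix.mul_apply, NE, map_mul, Matrix.zero_apply, map_zero] using this
  · intro q hq
    rw [zero_entry h hd (i+1) q r.1 hq r.2]; simp

theorem NE_single (h : Good R n rk deg dd) (i : ℕ) (k : Fin n) :
    NE deg dd i (Pi.single k 1) = NN deg dd i k := by
  ext p q
  simp only [NE, NN, eval_lin (lin_entry h i p.1 q.1 p.2 q.2)]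
  simp [Pi.single_apply]

theorem NE_add (h : Good R n rk deg dd) (i : ℕ) (s t : Fin n → R) :
    NE deg dd i (s + t) = NE deg dd i s + NE deg dd i t := by
  ext p q
  simp only [NE, Matrix.add_apply, eval_lin (lin_entry h i p.1 q.1 p.2 q.2)]
  simp [add_mul, sum_add_distrib]

theorem NN_ge (i k : ℕ) (hk : ¬ k < n) : NN deg dd i k = 0 := by
  ext p q; simp [NN, hk]

theorem NN_sq (h : Good R n rk deg dd) (hd : ∀ (i : ℕ) q, (i : ℤ) ≤ deg i q) (i k : ℕ) :
    NN deg dd i k * NN deg dd (i+1) k = 0 := by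
  by_cases hk : k < n
  · have := NE_mul h hd i (Pi.single ⟨k, hk⟩ 1)
    simpa only [NE_single h] using this
  · rw [NN_ge i k hk, Matrix.zero_mul]

theorem NN_anti (h : Good R n rk deg dd) (hd : ∀ (i : ℕ) q, (i : ℤ) ≤ deg i q) (i k l : ℕ) :
    NN deg dd i k * NN deg dd (i+1) l + NN deg dd i l * NN deg dd (i+1) k = 0 := by
  by_cases hk : k < n
  · by_cases hl : l < n
    · have := NE_mul h hd i (Pi.single ⟨k, hk⟩ 1 + Pi.single ⟨l, hl⟩ 1)
      simp only [NE_add h, NE_single h] at this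
      rw [Matrix.add_mul, Matrix.mul_add, Matrix.mul_add, NN_sq h hd, NN_sq h hd] at this
      simpa using this
    · rw [NN_ge i l hl, NN_ge (i+1) l hl]; simp
  · rw [NN_ge i k hk, NN_ge (i+1) k hk]; simp

open Classical in
/-- extension by zero -/
noncomputable def ext0 (i : ℕ) (w : Tau rk deg i → MvPolynomial (Fin n) R) :
    Fin (rk i) → MvPolynomial (Fin n) R :=
  fun q => if hq : deg i q = (i : ℕ) then w ⟨q, hq⟩ else 0

theorem ext0_val (i : ℕ) (w : Tau rk deg i → MvPolynomial (Fin n) R) (q : Tau rk deg i) :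
    ext0 i w q.1 = w q := by
  simp [ext0, q.2]

theorem dd_ext0 (h : Good R n rk deg dd) (hd : ∀ (i : ℕ) q, (i : ℤ) ≤ deg i q) (i : ℕ)
    (w : Tau rk deg (i+1) → MvPolynomial (Fin n) R)
    (hw : ∀ p : Tau rk deg i, ∑ q, (∑ k : Fin n, X k * C (NN deg dd i k p q)) * w q = 0) :
    dd i *ᵥ ext0 (i+1) w = 0 := by
  funext p
  simp only [Matrix.mulVec, dotProduct, Pi.zero_apply]
  rw [sum_sub (fun q => deg (i+1) q = (i+1 : ℕ))]
  · by_cases hp : deg i p = (i : ℕ)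
    · rw [← hw ⟨p, hp⟩]
      refine Finset.sum_congr rfl fun q _ => ?_
      rw [ext0_val]
      congr 1
      refine (lin_eq (lin_entry h i p q.1 hp q.2)).trans ?_
      refine Finset.sum_congr rfl fun k _ => ?_
      simp only [NN, Fin.is_lt, dif_pos, Fin.eta]
    · apply Finset.sum_eq_zero
      intro q _
      rw [zero_entry h hd i p q.1 hp q.2, zero_mul]
  · intro q hq
    simp only [ext0, dif_neg hq, mul_zero]

theorem NN_inj (h : Good R n rk deg dd) (hd : ∀ (i : ℕ) q, (i : ℤ) ≤ deg i q) (i : ℕ)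
    (w : Tau rk deg (i+1) → R) (hw : ∀ k < n, NN deg dd i k *ᵥ w = 0) : w = 0 := by
  obtain ⟨v, hv⟩ := h.2.1 i _ (dd_ext0 h hd i (fun q => C (w q)) (by
    intro p
    simp only [Finset.sum_mul]
    rw [Finset.sum_comm]
    apply Finset.sum_eq_zero
    intro k _
    have := congrFun (hw k k.2) p
    simp only [Matrix.mulVec, dotProduct, Pi.zero_apply] at this
    simp only [mul_assoc, ← C_mul]
    rw [← Finset.mul_sum, ← map_sum, this]; simp))
  funext q
  have := cc_mulVec h (i+1) v q.1
  rw [hv, ext0_val] at this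
  simpa using this

theorem NN_lift (h : Good R n rk deg dd) (hd : ∀ (i : ℕ) q, (i : ℤ) ≤ deg i q) (i : ℕ)
    (z : ℕ → Tau rk deg (i+1) → R) (h0 : ∀ k < n, NN deg dd i k *ᵥ (z k) = 0)
    (h1 : ∀ k < n, ∀ l < n, NN deg dd i k *ᵥ (z l) + NN deg dd i l *ᵥ (z k) = 0) :
    ∃ u, ∀ k < n, NN deg dd (i+1) k *ᵥ u = z k := by
  obtain ⟨v, hv⟩ := h.2.1 i _ (dd_ext0 h hd i (fun q => ∑ l : Fin n, X l * C (z l q)) (by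
    intro p
    have e : ∀ k l : Fin n, ∑ q, (X k * C (NN deg dd i k p q)) * (X l * C (z l q)) =
        X k * X l * C ((NN deg dd i k *ᵥ z l) p) := by
      intro k l
      simp only [Matrix.mulVec, dotProduct, map_sum, Finset.mul_sum, C_mul]
      exact Finset.sum_congr rfl fun q _ => by ring
    simp only [Finset.sum_mul_sum]
    rw [Finset.sum_comm]
    simp_rw [Finset.sum_comm (s := (Finset.univ : Finset (Tau rk deg (i+1)))), e]
    apply sum_alt
    · intro k; simp [h0 k k.2]
    · intro k l
      have := congrFun (h1 k k.2 l l.2) p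
      simp only [Pi.add_apply, Pi.zero_apply] at this
      rw [mul_comm (X l), ← mul_add, ← C_add, this]; simp))
  refine ⟨fun r => constantCoeff (v r.1), fun k hk => ?_⟩
  funext q
  have := congrArg (lk ⟨k, hk⟩) (congrFun hv q.1)
  rw [ext0_val, lk_sum] at this
  simp only [lk_X_mul_C, Finset.sum_ite_eq, Finset.mem_univ, if_true] at this
  rw [← this]
  simp only [Matrix.mulVec, dotProduct, lk_sum, lk_mul, cc_entry h, zero_mul, add_zero]
  rw [sum_sub (fun r => deg (i+1+1) r = (i+1+1 : ℕ))]
  · refine Finset.sum_congr rfl fun x _ => ?_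
    simp only [NN, hk, dif_pos]
  · intro r hr
    rw [lk_entry h hd (i+1) q.1 r q.2 hr, zero_mul]

/-- the counting map -/
noncomputable def cmap (deg : (i : ℕ) → Fin (rk i) → ℤ)
    (dd : (i : ℕ) → Matrix (Fin (rk i)) (Fin (rk (i+1))) (MvPolynomial (Fin n) R)) (p m : ℕ) :
    (Fin (p+1) × Fin m × Tau rk deg (p+1) → R) →ₗ[R]
      ((Σ j : Fin m, Fin (j+1)) × Tau rk deg p → R) :=
  LinearMap.pi fun x => LinearMap.proj x.2 ∘ₗ
    (if (x.1.2 : ℕ) = x.1.1 then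
      ∑ i : Fin (p+1), (NN deg dd p (i + x.1.1)).mulVecLin ∘ₗ
        LinearMap.funLeft R R (fun q => (i, x.1.1, q))
    else
      (∑ i : Fin (p+1), (NN deg dd p (i + x.1.1)).mulVecLin ∘ₗ
        LinearMap.funLeft R R (fun q => (i, ⟨x.1.2, by omega⟩, q))) +
      (∑ i : Fin (p+1), (NN deg dd p (i + x.1.2)).mulVecLin ∘ₗ
        LinearMap.funLeft R R (fun q => (i, x.1.1, q))))

theorem good_bound [IsDomain R] (h : Good R n rk deg dd) (hgen : ∀ p, 0 ≤ deg 0 p) (p : ℕ)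
    (hvan : ∀ q, deg (p+2) q ≠ (p+2 : ℕ)) :
    (p + 1 ≤ n → 2 * (p+1) * Fintype.card (Tau rk deg (p+1)) ≤
      (n - p + 1) * Fintype.card (Tau rk deg p)) ∧
    (n < p + 1 → Fintype.card (Tau rk deg (p+1)) = 0) := by
  have hd := deg_ge h hgen
  let T : ℕ → Type := fun i => Tau rk deg i → R
  let D : ∀ i, ℕ → T (i+1) →+ T i := fun i k => (NN deg dd i k).mulVecLin.toAddMonoidHom
  have hD : ∀ i k w, D i k w = NN deg dd i k *ᵥ w := fun _ _ _ => rfl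
  have hsq : ∀ i k (w : T (i+2)), D i k (D (i+1) k w) = 0 := by
    intro i k w
    rw [hD, hD, Matrix.mulVec_mulVec, NN_sq h hd, Matrix.zero_mulVec]
  have hanti : ∀ i k l (w : T (i+2)), D i k (D (i+1) l w) + D i l (D (i+1) k w) = 0 := by
    intro i k l w
    rw [hD, hD, hD, hD, Matrix.mulVec_mulVec, Matrix.mulVec_mulVec, ← Matrix.add_mulVec,
      NN_anti h hd, Matrix.zero_mulVec]
  have ha : ∀ i (w : T (i+1)), (∀ k < n, D i k w = 0) → w = 0 := fun i w => NN_inj h hd i w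
  have hb := fun i (z : ℕ → T (i+1)) => NN_lift h hd i z
  constructor
  · intro hpn
    obtain ⟨m, hm⟩ : ∃ m, n = p + m := ⟨n - p, by omega⟩
    have hv : ∀ u : T (p+2), u = 0 := by
      intro u; funext q; exact absurd q.2 (hvan q.1)
    have inj := T_inj T D hsq hanti n ha hb p m (by omega) hv
    have hinj : Function.Injective (cmap deg dd p m) := by
      rw [injective_iff_map_eq_zero]
      intro w hw
      let W : ℕ → ℕ → T (p+1) := fun i j q =>
        if hi : i < p + 1 then if hj : j < m then w (⟨i, hi⟩, ⟨j, hj⟩, q) else 0 else 0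
      have hW : ∀ (i : Fin (p+1)) (j : ℕ) (hj : j < m), W i j = fun q => w (i, ⟨j, hj⟩, q) := by
        intro i j hj; funext q; simp only [W, i.2, hj, dif_pos, Fin.eta]
      have e1 : ∀ j < m, ∑ i ∈ Finset.range (p+1), D p (i+j) (W i j) = 0 := by
        intro j hj
        funext s
        have := congrFun hw (⟨⟨j, hj⟩, ⟨j, by simp⟩⟩, s)
        rw [Finset.sum_range]
        simp only [hW _ j hj, hD]
        simp [cmap, LinearMap.funLeft, Function.comp_def] at this
        refine Eq.trans ?_ this
        exact Finset.sum_apply s _ _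
      have e2 : ∀ j < m, ∀ j' < j, ∑ i ∈ Finset.range (p+1), D p (i+j) (W i j') +
          ∑ i ∈ Finset.range (p+1), D p (i+j') (W i j) = 0 := by
        intro j hj j' hj'
        funext s
        have := congrFun hw (⟨⟨j, hj⟩, ⟨j', by simp; omega⟩⟩, s)
        rw [Finset.sum_range, Finset.sum_range]
        simp only [hW _ j hj, hW _ j' (hj'.trans hj), hD]
        simp [cmap, LinearMap.funLeft, Function.comp_def, hj'.ne] at this
        refine Eq.trans ?_ this
        exact congrArg₂ (fun a b : R => a + b) (Finset.sum_apply s _ _) (Finset.sum_apply s _ _)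
      have := inj W e1 (by
        intro j hj j' hj'
        rcases lt_trichotomy j j' with hlt | rfl | hlt
        · rw [add_comm]; exact e2 j' hj' j hlt
        · rw [e1 j hj, add_zero]
        · exact e2 j hj j' hlt)
      funext ⟨i, j, q⟩
      have h3 := congrFun (this i i.2 j j.2) q
      rw [hW i j j.2] at h3
      exact h3
    have hcard := card_le_of_injective R _ hinj
    simp only [Fintype.card_prod, Fintype.card_fin, Fintype.card_sigma] at hcard
    have gauss : 2 * ∑ j : Fin m, ((j : ℕ) + 1) = m * (m+1) := by
      rw [Fin.sum_univ_eq_sum_range (fun j => j + 1)]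
      clear * -
      induction m with
      | zero => simp
      | succ m ih => rw [Finset.sum_range_succ, mul_add, ih]; ring
    have hm1 : 0 < m := by omega
    have hmm : n - p + 1 = m + 1 := by omega
    rw [hmm]
    refine Nat.le_of_mul_le_mul_left ?_ hm1
    calc _ = 2 * ((p+1) * (m * Fintype.card (Tau rk deg (p+1)))) := by ring
      _ ≤ 2 * ((∑ j : Fin m, ((j : ℕ) + 1)) * Fintype.card (Tau rk deg p)) :=
        Nat.mul_le_mul_left _ hcard
      _ = _ := by rw [← mul_assoc, gauss]; ring
  · intro hn
    rw [Fintype.card_eq_zero_iff]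
    refine ⟨fun q => ?_⟩
    have := T_eq_zero_of_gt T D hsq hanti n ha (p+1) hn (fun _ => 1)
    exact one_ne_zero (congrFun this q)

end G

end Red


namespace Red

theorem good_of_F (K : Type) [Field K] (n : ℕ) (F : FreeComplex K n) (h1 : IsResolution F)
    (h2 : IsMinimal F) : Good K n F.rk F.deg F.dd := by
  refine ⟨F.isComplex, ?_, ?_⟩
  · intro i z hz
    have : z ∈ LinearMap.ker ((F.dd i).mulVecLin) := hz
    rw [h1 i] at this
    exact this
  · intro i p q
    have hh := F.isHomog i p q
    by_cases hz : 0 ≤ F.deg (i+1) q - F.deg i p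
    · by_cases h0 : F.deg (i+1) q = F.deg i p
      · left; exact h2 i p q h0
      · right
        refine ⟨(F.deg (i+1) q - F.deg i p).toNat - 1, by omega, ?_⟩
        have e : (F.deg (i+1) q - F.deg i p).toNat - 1 + 1 = (F.deg (i+1) q - F.deg i p).toNat := by
          omega
        rw [e]
        rw [homogZ, iSup_pos hz] at hh
        exact hh
    · left
      rw [homogZ, iSup_neg hz] at hh
      exact (Submodule.mem_bot K).mp hh

theorem betti_card (K : Type) [Field K] (n : ℕ) (F : FreeComplex K n) (i : ℕ) :
    bettiNum F i (i : ℤ) = Fintype.card (Tau F.rk F.deg i) := by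
  rw [Fintype.card_subtype]; rfl

end Red

/-- Let `K` be any field and `M` a graded Cohen-Macaulay module
of projective dimension `≤ c` over `K[x_1, …, x_n]`, generated in degrees `≥ 0`.
If `β_{p+1,p+1}(M) = 0` for some `p ≥ 1`, then
`β_{p,p}(M) ≤ ((c+2-p)/(2p)) β_{p-1,p-1}(M)`.
(Here `M = coker (F₁ → F₀)` for its minimal free resolution `F`, and the
statement's `p ≥ 1` is written as `p + 1` for a natural number `p`.) -/
theorem consecutive_betti_bound (K : Type) [Field K] (n c : ℕ)
    (F : FreeComplex K n)
    (hCM : ∃ c' ≤ c, IsCMcodim F c')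
    (hgen : ∀ p : Fin (F.rk 0), 0 ≤ F.deg 0 p)
    (p : ℕ)
    (hvan : bettiNum F (p + 2) ((p : ℤ) + 2) = 0) :
    (bettiNum F (p + 1) ((p : ℤ) + 1) : ℚ) ≤
      (((c : ℚ) + 2 - ((p : ℚ) + 1)) / (2 * ((p : ℚ) + 1))) * bettiNum F p (p : ℤ) := by
  obtain ⟨c', hc', hres, hmin, hr, -, -⟩ := hCM
  obtain ⟨R, _, _, n', hn', dd', hgood⟩ := Red.good_reduce c F.rk F.deg
    (fun i hi => hr i (by omega)) n K F.dd (Red.good_of_F K n F hres hmin)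
  have hb := Red.good_bound hgood hgen p (by
    intro q hq
    have h0 := Finset.card_eq_zero.mp hvan
    have : q ∈ (Finset.univ.filter fun q => F.deg (p+2) q = (p : ℤ) + 2) := by
      simp only [Finset.mem_filter, Finset.mem_univ, true_and]
      rw [hq]; push_cast; ring
    rw [h0] at this
    exact absurd this (Finset.notMem_empty _))
  have e1 : bettiNum F (p+1) ((p : ℤ) + 1) = Fintype.card (Red.Tau F.rk F.deg (p+1)) := by
    rw [← Red.betti_card]; push_cast; rfl
  have e0 := Red.betti_card K n F p
  rw [e1, e0]
  have hp : (0 : ℚ) < 2 * ((p : ℚ) + 1) := by positivity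
  by_cases hpn : p + 1 ≤ n'
  · have h1 := hb.1 hpn
    have h2 : (2 * (p + 1) * Fintype.card (Red.Tau F.rk F.deg (p+1)) : ℚ) ≤
        ((c : ℚ) - p + 1) * Fintype.card (Red.Tau F.rk F.deg p) := by
      have h3 : (n' - p + 1) * Fintype.card (Red.Tau F.rk F.deg p) ≤
          (c - p + 1) * Fintype.card (Red.Tau F.rk F.deg p) :=
        Nat.mul_le_mul_right _ (by omega)
      have h4 := h1.trans h3
      have h5 : ((c - p : ℕ) : ℚ) = (c : ℚ) - p := by
        rw [Nat.cast_sub (by omega)]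
      rw [← h5]
      exact_mod_cast h4
    rw [div_mul_eq_mul_div, le_div_iff₀ hp]
    linarith
  · rw [hb.2 (by omega)]
    by_cases hpc : p ≤ c + 1
    · have : (p : ℚ) ≤ c + 1 := by exact_mod_cast hpc
      have h1 : (0 : ℚ) ≤ (c : ℚ) + 2 - (p + 1) := by linarith
      simp only [Nat.cast_zero]
      positivity
    · have : Fintype.card (Red.Tau F.rk F.deg p) = 0 := by
        rw [Fintype.card_eq_zero_iff]
        refine ⟨fun q => ?_⟩
        have h0 := hr p (by omega)
        exact absurd q.1.2 (by omega)
      rw [this]; simp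

end
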